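/- Let E = ℝ × ℝⁿ × ℝⁿ × ℝ^{k+r} with coordinates (t, q^i, v^i, s^α, u^a), κ^i = dq^i − v^i dt, I₁^{vak} = ⟨κ^i⟩, I₁^{nh} = ⟨η¹,…,η^k⟩, and I₀ ⊆ C∞(E). Assume the constraints are compatible: (1) I₁^{nh} has the k generators η^α; (2) τ ∧ η¹ ∧ … ∧ η^k ∧ κ¹ ∧ dκ¹ ∧ … ∧ κⁿ ∧ dκⁿ vanishes nowhere; (3) i_{∂/∂v^i}η^α = 0 for all i and α. Then, for any smooth L : E → ℝ, the variational problem (L dt, (I₀, I₁^{nh}, I₁^{vak}), Adm) is dynamically equivalent to the variational problem (Θ_L, (I₀, I₁^{nh}, I₁^{vak}), ⟨Adm⟩^{B(π)}), where Θ_L = L dt + (∂L/∂v^i)κ^i. -/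

import Mathlib

open MeasureTheory Set Finset
open scoped ContDiff

noncomputable section

namespace VPGeom

variable {E : Type*} [NormedAddCommGroup E] [NormedSpace ℝ E]

/-- A smooth `k`-form in the function model: jointly smooth and, at each point,
given by an alternating multilinear map on the tangent space. -/
def IsFormK (k : ℕ) (α : E → (Fin k → E) → ℝ) : Prop :=
  ContDiff ℝ ∞ (fun p : E × (Fin k → E) => α p.1 p.2) ∧
    ∀ x : E, ∃ m : AlternatingMap ℝ E ℝ (Fin k), ∀ v, α x v = m v

/-- A smooth `1`-form in the function model. -/
def IsForm1 (θ : E → E → ℝ) : Prop :=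
  ContDiff ℝ ∞ (fun p : E × E => θ p.1 p.2) ∧ ∀ x : E, IsLinearMap ℝ (θ x)

/-- A smooth `2`-form in the function model. -/
def IsForm2 (Ω : E → E → E → ℝ) : Prop :=
  ContDiff ℝ ∞ (fun p : E × E × E => Ω p.1 p.2.1 p.2.2) ∧
    ∀ x : E, ∃ m : AlternatingMap ℝ E ℝ (Fin 2), ∀ u v : E, Ω x u v = m ![u, v]

/-- Exterior derivative of a `1`-form on a vector space
(formula with constant extensions of the tangent vectors). -/
def extd1 (θ : E → E → ℝ) : E → E → E → ℝ := fun x u v =>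
  fderiv ℝ (fun y => θ y v) x u - fderiv ℝ (fun y => θ y u) x v

/-- Exterior derivative of a `2`-form on a vector space. -/
def extd2 (Ω : E → E → E → ℝ) : E → E → E → E → ℝ := fun x u v w =>
  fderiv ℝ (fun y => Ω y v w) x u - fderiv ℝ (fun y => Ω y u w) x v +
    fderiv ℝ (fun y => Ω y u v) x w

/-- Lie derivative of a `1`-form along a vector field (on a vector space). -/
def lie1 (ξ : E → E) (θ : E → E → ℝ) : E → E → ℝ := fun x v =>
  fderiv ℝ (fun y => θ y v) x (ξ x) + θ x (fderiv ℝ ξ x v)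

/-- Wedge product of two `1`-forms. -/
def wedge11 (α β : E → E → ℝ) : E → E → E → ℝ := fun x u v =>
  α x u * β x v - α x v * β x u

/-- Wedge product of a `2`-form with a `1`-form. -/
def wedge21 (β : E → E → E → ℝ) (α : E → E → ℝ) : E → E → E → E → ℝ := fun x u v w =>
  β x u v * α x w - β x u w * α x v + β x v w * α x u

/-- Wedge product of a `1`-form with a `2`-form. -/
def wedge12 (α : E → E → ℝ) (β : E → E → E → ℝ) : E → E → E → E → ℝ := fun x u v w =>
  α x u * β x v w - α x v * β x u w + α x w * β x u v

/-- Interior product of a vector field with a `2`-form. -/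
def iota2 (ξ : E → E) (Ω : E → E → E → ℝ) : E → E → ℝ := fun x v => Ω x (ξ x) v

/-- `γ` is a smooth local section, over the open interval `I`, of the bundle over `ℝ`
whose projection ("time coordinate") is `T`. -/
structure IsSection (T : E → ℝ) (γ : ℝ → E) (I : Set ℝ) : Prop where
  isOpen : IsOpen I
  ordConnected : I.OrdConnected
  nonempty : I.Nonempty
  smooth : ContDiffOn ℝ ∞ γ I
  proj : ∀ t ∈ I, T (γ t) = t

/-- Membership in the `C^∞(E)`-ideal generated by a set of functions. -/
def InIdeal (I₀ : Set (E → ℝ)) (h : E → ℝ) : Prop :=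
  ∃ (m : ℕ) (f : Fin m → E → ℝ) (g : Fin m → E → ℝ),
    (∀ j, ContDiff ℝ ∞ (f j)) ∧ (∀ j, g j ∈ I₀) ∧ h = fun x => ∑ j, f j x * g j x

end VPGeom
namespace VPGeom

/-- `E = J¹ρ × N ≅ ℝ × ℝⁿ × ℝⁿ × ℝᵏ × ℝʳ` with coordinates `(t, qⁱ, vⁱ, sᵅ, uᵃ)`. -/
abbrev E12 (n k r : ℕ) := ℝ × (Fin n → ℝ) × (Fin n → ℝ) × (Fin k → ℝ) × (Fin r → ℝ)

/-- The Cartan 1-forms `κⁱ = dqⁱ - vⁱ dt` pulled back to `E`. -/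
def kap12 (n k r : ℕ) (i : Fin n) : E12 n k r → E12 n k r → ℝ := fun x w =>
  w.2.1 i - x.2.2.1 i * w.1

/-- `∂L/∂vⁱ`. -/
def dLv12 (n k r : ℕ) (L : E12 n k r → ℝ) (i : Fin n) : E12 n k r → ℝ := fun x =>
  fderiv ℝ L x ((0 : ℝ), (0 : Fin n → ℝ), Pi.single i 1, (0 : Fin k → ℝ), (0 : Fin r → ℝ))

/-- The Poincaré–Cartan 1-form `Θ_L = L dt + (∂L/∂vⁱ) κⁱ`. -/
def ThetaL12 (n k r : ℕ) (L : E12 n k r → ℝ) : E12 n k r → E12 n k r → ℝ := fun x w =>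
  L x * w.1 + ∑ i, dLv12 n k r L i x * kap12 n k r i x w

/-- The constraints `I₁ⁿʰ = ⟨η¹,…,ηᵏ⟩` and `I₁ᵛᵃᵏ = ⟨κ¹,…,κⁿ⟩` are compatible:
the `ηᵅ` number `k`; the wedge `τ ∧ (⋀ηᵅ) ∧ (⋀ κⁱ ∧ dκⁱ)` vanishes nowhere (expressed as the
pointwise linear independence of the covectors `τ, ηᵅ, κⁱ, dvⁱ`, which is the value of that
wedge condition since `dκⁱ = dt ∧ dvⁱ`); and `C ⊆ ⋂ ker ηᵅ`, i.e. `i_{∂/∂vⁱ} ηᵅ = 0`. -/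
def CompatibleConstraints (n k r : ℕ) (η : Fin k → E12 n k r → E12 n k r → ℝ) : Prop :=
  (∀ x : E12 n k r, LinearIndependent ℝ
    (Fin.cons (fun w : E12 n k r => w.1)
      (Fin.append (fun a : Fin k => η a x)
        (Fin.append (fun i : Fin n => kap12 n k r i x)
          (fun i : Fin n => fun w : E12 n k r => w.2.2.1 i))) :
      Fin (k + (n + n) + 1) → E12 n k r → ℝ)) ∧
  (∀ (i : Fin n) (a : Fin k) (x : E12 n k r),
    η a x ((0 : ℝ), (0 : Fin n → ℝ), Pi.single i 1, (0 : Fin k → ℝ), (0 : Fin r → ℝ)) = 0)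

/-- Membership in the `C^∞(E)`-module `⟨I₁ᵛᵃᵏ, I₁ⁿʰ⟩` generated by the `κⁱ` and the `ηᵅ`. -/
def InKapEtaSpan (n k r : ℕ) (η : Fin k → E12 n k r → E12 n k r → ℝ)
    (α : E12 n k r → E12 n k r → ℝ) : Prop :=
  ∃ (f : Fin n → E12 n k r → ℝ) (g : Fin k → E12 n k r → ℝ),
    (∀ j, ContDiff ℝ ∞ (f j)) ∧ (∀ a, ContDiff ℝ ∞ (g a)) ∧
    ∀ x w, α x w = ∑ j, f j x * kap12 n k r j x w + ∑ a, g a x * η a x w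

/-- The admissible variations: vertical smooth vector fields `ξ` with `i_ξ ηᵅ ∈ (I₀)` and
`ℒ_ξ κⁱ ∈ ⟨I₁ᵛᵃᵏ, I₁ⁿʰ⟩`. -/
def Adm12 (n k r : ℕ) (I₀ : Set (E12 n k r → ℝ))
    (η : Fin k → E12 n k r → E12 n k r → ℝ) : Set (E12 n k r → E12 n k r) :=
  {ξ | ContDiff ℝ ∞ ξ ∧ (∀ x, (ξ x).1 = 0) ∧
    (∀ a : Fin k, InIdeal I₀ fun x => η a x (ξ x)) ∧
    ∀ i : Fin n, InKapEtaSpan n k r η (lie1 ξ (kap12 n k r i))}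

/-- `⟨A⟩^{B(π)}`: all finite `B(π)`-linear combinations of elements of `A`. -/
def BSpan12 (n k r : ℕ) (A : Set (E12 n k r → E12 n k r)) : Set (E12 n k r → E12 n k r) :=
  {ξ | ∃ (m : ℕ) (g : Fin m → ℝ → ℝ) (ζ : Fin m → E12 n k r → E12 n k r),
    (∀ j, ContDiff ℝ ∞ (g j)) ∧ (∀ j, ζ j ∈ A) ∧ ξ = fun x => ∑ j, g j x.1 • ζ j x}

/-- The π-vertical smooth vector fields `Γ(V(π))`. -/
def Vert12 (n k r : ℕ) : Set (E12 n k r → E12 n k r) :=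
  {ξ | ContDiff ℝ ∞ ξ ∧ ∀ x, (ξ x).1 = 0}

end VPGeom

namespace VPGeom

/-- Solution sections of a variational problem `(θ, (I₀, I₁ⁿʰ, I₁ᵛᵃᵏ), A)`. -/
def IsVPSol12 (n k r : ℕ) (θ : E12 n k r → E12 n k r → ℝ) (I₀ : Set (E12 n k r → ℝ))
    (η : Fin k → E12 n k r → E12 n k r → ℝ) (A : Set (E12 n k r → E12 n k r))
    (γ : ℝ → E12 n k r) (I : Set ℝ) : Prop :=
  IsSection Prod.fst γ I ∧
  (∀ f ∈ I₀, ∀ t ∈ I, f (γ t) = 0) ∧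
  (∀ a : Fin k, ∀ t ∈ I, η a (γ t) (deriv γ t) = 0) ∧
  (∀ i : Fin n, ∀ t ∈ I, kap12 n k r i (γ t) (deriv γ t) = 0) ∧
  ∀ K : Set ℝ, IsCompact K → K ⊆ I →
    ∀ ξ ∈ A, (∀ t ∈ frontier K, ξ (γ t) = 0) →
      ∫ t in K, lie1 ξ θ (γ t) (deriv γ t) = 0

/-- The zeros of a real function at which its derivative exists and is nonzero are countable. -/
theorem countable_zeros_of_hasDerivAt_ne_zero {B B' : ℝ → ℝ} {S : Set ℝ}
    (hB : ∀ t ∈ S, HasDerivAt B (B' t) t) (h0 : ∀ t ∈ S, B t = 0) (hne : ∀ t ∈ S, B' t ≠ 0) :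
    S.Countable := by
  refine (HereditarilyLindelofSpace.isLindelof S).countable_of_isDiscrete
    (isDiscrete_iff_nhdsNE.2 fun t ht => ?_)
  have h := (hB t ht).eventually_ne (c := 0) (hne t ht)
  refine Filter.empty_mem_iff_bot.1 (Filter.mem_inf_iff.2 ⟨_, h, S, Filter.mem_principal_self S, ?_⟩)
  ext z
  simp only [Set.mem_empty_iff_false, Set.mem_inter_iff, Set.mem_ofPred_eq, false_iff, not_and]
  exact fun hz hS => hz (h0 z hS)

/-- The fundamental theorem of calculus on an arbitrary compact set `K`, for a function
vanishing on the frontier of `K`. -/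
theorem setIntegral_deriv_eq_zero_of_frontier {B B' : ℝ → ℝ} {K : Set ℝ} (hK : IsCompact K)
    (hB : ∀ t ∈ K, HasDerivAt B (B' t) t) (hB' : ContinuousOn B' K)
    (h0 : ∀ t ∈ frontier K, B t = 0) : ∫ t in K, B' t = 0 := by
  obtain ⟨R, hR⟩ := hK.isBounded.subset_closedBall (0 : ℝ)
  rw [Real.closedBall_eq_Icc] at hR
  set a := min (0 - R) 0 - 1
  set b := max (0 + R) 0 + 1
  have hab : a ≤ b := by
    have h₁ := min_le_right (0 - R) 0
    have h₂ := le_max_right (0 + R) 0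
    grind
  have hKab : K ⊆ Set.Ioc a b := fun t ht => by
    have h₁ := min_le_left (0 - R) 0
    have h₂ := le_max_left (0 + R) 0
    have h₃ := hR ht
    simp only [Set.mem_Icc, Set.mem_Ioc] at *
    grind
  have hab' : a ∉ K ∧ (b ∉ K) := by
    have h₁ := min_le_left (0 - R) 0
    have h₂ := le_max_left (0 + R) 0
    refine ⟨fun h => ?_, fun h => ?_⟩ <;> have h₃ := hR h <;> simp only [Set.mem_Icc] at h₃ <;> grind
  have hfr : frontier K ⊆ K := hK.isClosed.frontier_subset
  have hint : IntegrableOn B' K := hB'.integrableOn_compact hK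
  have hcount : {t ∈ frontier K | B' t ≠ 0}.Countable :=
    countable_zeros_of_hasDerivAt_ne_zero (B' := B') (fun t ht => hB t (hfr ht.1))
      (fun t ht => h0 t ht.1) fun t ht => ht.2
  have hcont : Continuous (K.indicator B) :=
    continuous_indicator h0 fun t ht =>
      (hB t (hK.isClosed.closure_eq ▸ ht)).continuousAt.continuousWithinAt
  have key := integral_eq_of_hasDerivAt_off_countable_of_le (K.indicator B)
    (K.indicator B') hab hcount hcont.continuousOn ?_ ?_
  · rw [intervalIntegral.integral_of_le hab, setIntegral_indicator hK.measurableSet,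
      Set.inter_eq_self_of_subset_right hKab, Set.indicator_of_notMem hab'.1,
      Set.indicator_of_notMem hab'.2, sub_zero] at key
    exact key
  · rintro t ⟨-, ht⟩
    by_cases htK : t ∈ K
    · by_cases hti : t ∈ interior K
      · rw [Set.indicator_of_mem htK]
        refine (hB t htK).congr_of_eventuallyEq ?_
        filter_upwards [isOpen_interior.mem_nhds hti] with s hs
        exact Set.indicator_of_mem (interior_subset hs) _
      · have htf : t ∈ frontier K := ⟨subset_closure htK, hti⟩
        have hz : B' t = 0 := by
          by_contra hne
          exact ht ⟨htf, hne⟩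
        have hd := hB t htK
        rw [Set.indicator_of_mem htK, hz]
        rw [hz, hasDerivAt_iff_isLittleO] at hd
        rw [hasDerivAt_iff_isLittleO]
        refine Asymptotics.IsBigO.trans_isLittleO (Asymptotics.IsBigO.of_bound 1 ?_) hd
        filter_upwards with s
        rw [Set.indicator_of_mem htK, h0 t htf]
        simp only [sub_zero, smul_zero, one_mul]
        exact norm_indicator_le_norm_self _ _
    · rw [Set.indicator_of_notMem htK]
      refine (hasDerivAt_const t (0 : ℝ)).congr_of_eventuallyEq ?_
      filter_upwards [hK.isClosed.isOpen_compl.mem_nhds htK] with s hs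
      exact Set.indicator_of_notMem hs _
  · exact ((integrable_indicator_iff hK.measurableSet).2 hint).intervalIntegrable

/-- A continuous function vanishing off the support of `φ` also vanishes on the frontier of
that support. -/
theorem eq_zero_of_mem_frontier_tsupport {φ ψ : ℝ → ℝ} (hψ : Continuous ψ)
    (h : ∀ t ∉ tsupport φ, ψ t = 0) : ∀ t ∈ frontier (tsupport φ), ψ t = 0 := by
  intro t ht
  rw [← frontier_compl] at ht
  have hcl : closure (tsupport φ)ᶜ ⊆ {t | ψ t = 0} :=
    closure_minimal (fun s hs => h s hs) (isClosed_eq hψ continuous_const)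
  exact hcl ht.1

/-- The fundamental lemma of the calculus of variations, in a form where the weak equation
`∫ (φ A + φ' B) = 0` yields `∫_K A = 0` for each compact `K` with `B = 0` on `∂K`. -/
theorem setIntegral_eq_zero_of_weak_eq {A B : ℝ → ℝ} {I K : Set ℝ} (hI : IsOpen I)
    (hA : ContinuousOn A I) (hB : ContDiffOn ℝ 1 B I)
    (hweak : ∀ φ : ℝ → ℝ, ContDiff ℝ ∞ φ → HasCompactSupport φ → tsupport φ ⊆ I →
      ∫ t in tsupport φ, (φ t * A t + deriv φ t * B t) = 0)
    (hK : IsCompact K) (hKI : K ⊆ I) (h0 : ∀ t ∈ frontier K, B t = 0) :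
    ∫ t in K, A t = 0 := by
  have hdB : ∀ t ∈ I, HasDerivAt B (deriv B t) t := fun t ht =>
    ((hB.differentiableOn one_ne_zero).differentiableAt (hI.mem_nhds ht)).hasDerivAt
  have hcB : ContinuousOn (deriv B) I := hB.continuousOn_deriv_of_isOpen hI le_rfl
  have hae : ∀ᵐ t, t ∈ I → A t - deriv B t = 0 := by
    refine hI.ae_eq_zero_of_integral_contDiff_smul_eq_zero
      ((hA.sub hcB).locallyIntegrableOn hI.measurableSet) fun φ hφ hφc hφI => ?_
    have hφ' : Continuous (deriv φ) := hφ.continuous_deriv (by simp)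
    have hφd : ∀ t, HasDerivAt φ (deriv φ t) t := fun t =>
      (hφ.differentiable (by simp) t).hasDerivAt
    have hfr := eq_zero_of_mem_frontier_tsupport hφ.continuous
      fun t ht => image_eq_zero_of_notMem_tsupport ht
    have h₁ := setIntegral_deriv_eq_zero_of_frontier (B := fun t => φ t * B t) hφc
      (fun t ht => (hφd t).mul (hdB t (hφI ht)))
      ((hφ'.continuousOn.mul (hB.continuousOn.mono hφI)).add
        (hφ.continuous.continuousOn.mul (hcB.mono hφI)))
      fun t ht => by rw [hfr t ht, zero_mul]
    have h₂ := hweak φ hφ hφc hφI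
    rw [← setIntegral_eq_integral_of_forall_compl_eq_zero (s := tsupport φ)
      fun t ht => by rw [image_eq_zero_of_notMem_tsupport ht, zero_smul]]
    rw [← sub_eq_zero.2 (h₂.trans h₁.symm), ← integral_sub]
    · congr 1
      ext t
      simp only [smul_eq_mul]
      ring
    · exact ((hφ.continuous.continuousOn.mul (hA.mono hφI)).add
        (hφ'.continuousOn.mul (hB.continuousOn.mono hφI))).integrableOn_compact hφc
    · exact ((hφ'.continuousOn.mul (hB.continuousOn.mono hφI)).add
        (hφ.continuous.continuousOn.mul (hcB.mono hφI))).integrableOn_compact hφc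
  rw [← setIntegral_deriv_eq_zero_of_frontier hK (fun t ht => hdB t (hKI ht)) (hcB.mono hKI) h0]
  refine setIntegral_congr_ae hK.measurableSet ?_
  filter_upwards [hae] with t ht htK
  exact sub_eq_zero.1 (ht (hKI htK))

section Geometry

variable {n k r : ℕ}

/-- The constant-coefficient vector `cⁱ ∂/∂vⁱ`. -/
def velVec (n k r : ℕ) : (Fin n → ℝ) →L[ℝ] E12 n k r :=
  (0 : (Fin n → ℝ) →L[ℝ] ℝ).prod ((0 : (Fin n → ℝ) →L[ℝ] (Fin n → ℝ)).prod
    ((ContinuousLinearMap.id ℝ (Fin n → ℝ)).prod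
      ((0 : (Fin n → ℝ) →L[ℝ] (Fin k → ℝ)).prod (0 : (Fin n → ℝ) →L[ℝ] (Fin r → ℝ)))))

theorem velVec_apply (c : Fin n → ℝ) : velVec n k r c = (0, 0, c, 0, 0) := rfl

theorem map_velVec {ℓ : E12 n k r → ℝ} (hℓ : IsLinearMap ℝ ℓ) (c : Fin n → ℝ) :
    ℓ (velVec n k r c) = ∑ i, c i * ℓ (0, 0, Pi.single i 1, 0, 0) := by
  have h := LinearMap.pi_apply_eq_sum_univ
    ((hℓ.mk' ℓ).comp (velVec n k r : (Fin n → ℝ) →ₗ[ℝ] E12 n k r)) c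
  simp only [LinearMap.comp_apply, ContinuousLinearMap.coe_coe, IsLinearMap.mk'_apply,
    smul_eq_mul] at h
  rw [h]
  refine Finset.sum_congr rfl fun i _ => ?_
  rw [velVec_apply]
  congr 5
  ext j
  simp [Pi.single_apply, eq_comm]

theorem fderiv_velVec {L : E12 n k r → ℝ} (x : E12 n k r) (c : Fin n → ℝ) :
    fderiv ℝ L x (velVec n k r c) = ∑ i, dLv12 n k r L i x * c i := by
  rw [map_velVec (fderiv ℝ L x).isBoundedLinearMap.toIsLinearMap]
  exact Finset.sum_congr rfl fun i _ => mul_comm _ _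

theorem fderiv_fst_eq_zero {ξ : E12 n k r → E12 n k r} (hξ : Differentiable ℝ ξ)
    (hv : ∀ x, (ξ x).1 = 0) (x w : E12 n k r) : (fderiv ℝ ξ x w).1 = 0 := by
  have h := (hξ x).hasFDerivAt.fst
  have h₂ : (fun y => (ξ y).1) = fun _ => (0 : ℝ) := funext hv
  rw [h₂] at h
  exact DFunLike.congr_fun (h.unique (hasFDerivAt_const 0 x)) w

theorem hasFDerivAt_coord (ξ : E12 n k r → E12 n k r) (hξ : Differentiable ℝ ξ) (i : Fin n)
    (x : E12 n k r) : HasFDerivAt (fun y => (ξ y).2.1 i)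
      ((ContinuousLinearMap.proj i).comp ((ContinuousLinearMap.fst ℝ _ _).comp
        ((ContinuousLinearMap.snd ℝ _ _).comp (fderiv ℝ ξ x)))) x :=
  hasFDerivAt_pi'.1 (hξ x).hasFDerivAt.snd.fst i

theorem fderiv_coord {ξ : E12 n k r → E12 n k r} (hξ : Differentiable ℝ ξ) (i : Fin n)
    (x w : E12 n k r) : (fderiv ℝ ξ x w).2.1 i = fderiv ℝ (fun y => (ξ y).2.1 i) x w := by
  rw [(hasFDerivAt_coord ξ hξ i x).fderiv]
  rfl

theorem hasFDerivAt_kap12 (i : Fin n) (x w : E12 n k r) :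
    HasFDerivAt (fun y => kap12 n k r i y w)
      (-(w.1 • (ContinuousLinearMap.proj i).comp ((ContinuousLinearMap.fst ℝ _ _).comp
        ((ContinuousLinearMap.snd ℝ _ _).comp (ContinuousLinearMap.snd ℝ _ _))))) x := by
  have h := hasFDerivAt_pi'.1 (hasFDerivAt_id (𝕜 := ℝ) x).snd.snd.fst i
  exact (h.mul_const w.1).const_sub (w.2.1 i)

/-- For vertical `ξ` with components `Xⁱ`, `Yⁱ` along `∂/∂qⁱ`, `∂/∂vⁱ`:
`ℒ_ξ κⁱ = dXⁱ - Yⁱ dt`. -/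
theorem lie1_kap12 {ξ : E12 n k r → E12 n k r} (hξ : Differentiable ℝ ξ)
    (hv : ∀ x, (ξ x).1 = 0) (i : Fin n) (x w : E12 n k r) :
    lie1 ξ (kap12 n k r i) x w =
      fderiv ℝ (fun y => (ξ y).2.1 i) x w - (ξ x).2.2.1 i * w.1 := by
  rw [lie1, (hasFDerivAt_kap12 i x w).fderiv, ← fderiv_coord hξ, kap12,
    fderiv_fst_eq_zero hξ hv]
  simp
  ring

theorem lie1_time {ξ : E12 n k r → E12 n k r} (hξ : Differentiable ℝ ξ)
    (hv : ∀ x, (ξ x).1 = 0) {L : E12 n k r → ℝ} (hL : Differentiable ℝ L) (x w : E12 n k r) :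
    lie1 ξ (fun x w => L x * w.1) x w = fderiv ℝ L x (ξ x) * w.1 := by
  rw [lie1, ((hL x).hasFDerivAt.mul_const w.1).fderiv, fderiv_fst_eq_zero hξ hv]
  simp [mul_comm]

theorem contDiff_dLv12 {L : E12 n k r → ℝ} (hL : ContDiff ℝ ∞ L) (i : Fin n) :
    ContDiff ℝ ∞ (dLv12 n k r L i) :=
  (hL.fderiv_right (m := ∞) (by simp)).clm_apply contDiff_const

/-- `ℒ_ξ Θ_L` on a tangent vector `w` annihilated by the `κⁱ` and with `τ(w) = 1`. -/
theorem lie1_ThetaL12 {ξ : E12 n k r → E12 n k r} (hξ : Differentiable ℝ ξ)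
    (hv : ∀ x, (ξ x).1 = 0) {L : E12 n k r → ℝ} (hL : ContDiff ℝ ∞ L) {x w : E12 n k r}
    (hw : w.1 = 1) (hκ : ∀ i, kap12 n k r i x w = 0) :
    lie1 ξ (ThetaL12 n k r L) x w =
      fderiv ℝ L x (ξ x + velVec n k r fun i => lie1 ξ (kap12 n k r i) x w) := by
  have hd := ((hL.differentiable (by simp) x).hasFDerivAt.mul_const w.1).add
    (HasFDerivAt.fun_sum (u := Finset.univ) fun i _ =>
      ((contDiff_dLv12 hL i).differentiable (by simp) x).hasFDerivAt.mul
        (hasFDerivAt_kap12 i x w))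
  have hd' : fderiv ℝ (fun y => ThetaL12 n k r L y w) x = _ := hd.fderiv
  rw [map_add, fderiv_velVec, lie1, hd']
  simp only [lie1, (hasFDerivAt_kap12 _ x w).fderiv, ThetaL12, fderiv_fst_eq_zero hξ hv]
  simp [hw, hκ, Finset.sum_add_distrib, mul_add]
  ring

/-- The field `Σ_j (g_j ζ_j + g_j' X_jⁱ ∂/∂vⁱ)`, where `X_jⁱ` is the `∂/∂qⁱ`-component of `ζ_j`:
the correction of a `B(π)`-linear combination that makes it admissible. -/
def prolong {m : ℕ} (g : Fin m → ℝ → ℝ) (ζ : Fin m → E12 n k r → E12 n k r) :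
    E12 n k r → E12 n k r := fun x =>
  ∑ j, g j x.1 • ζ j x + velVec n k r (∑ j, deriv (g j) x.1 • (ζ j x).2.1)

variable {m : ℕ} {g : Fin m → ℝ → ℝ} {ζ : Fin m → E12 n k r → E12 n k r}

theorem contDiff_sum_smul (hg : ∀ j, ContDiff ℝ ∞ (g j)) (hζ : ∀ j, ContDiff ℝ ∞ (ζ j)) :
    ContDiff ℝ ∞ fun x : E12 n k r => ∑ j, g j x.1 • ζ j x :=
  ContDiff.sum fun j _ => ((hg j).comp contDiff_fst).smul (hζ j)

theorem contDiff_prolong (hg : ∀ j, ContDiff ℝ ∞ (g j)) (hζ : ∀ j, ContDiff ℝ ∞ (ζ j)) :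
    ContDiff ℝ ∞ (prolong g ζ) := by
  refine (contDiff_sum_smul hg hζ).add ((velVec n k r).contDiff.comp
    (ContDiff.sum fun j _ => ContDiff.fun_smul (f := fun x : E12 n k r => deriv (g j) x.1)
      (ContDiff.comp (n := ∞) (g := deriv (g j)) ?_ contDiff_fst) ?_))
  · exact (contDiff_infty_iff_deriv.1 (hg j)).2
  · exact (hζ j).snd.fst

theorem sum_smul_fst (hv : ∀ j x, (ζ j x).1 = 0) (x : E12 n k r) :
    (∑ j, g j x.1 • ζ j x).1 = 0 := by
  simp [Prod.fst_sum, hv]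

theorem prolong_fst (hv : ∀ j x, (ζ j x).1 = 0) (x : E12 n k r) : (prolong g ζ x).1 = 0 :=
  (add_zero _).trans (sum_smul_fst hv x)

theorem prolong_coord (x : E12 n k r) :
    (prolong g ζ x).2.1 = (∑ j, g j x.1 • ζ j x).2.1 :=
  add_zero _

theorem prolong_velocity (x : E12 n k r) :
    (prolong g ζ x).2.2.1 = (∑ j, g j x.1 • ζ j x).2.2.1 + ∑ j, deriv (g j) x.1 • (ζ j x).2.1 :=
  rfl

theorem sum_smul_coord (i : Fin n) (x : E12 n k r) :
    (∑ j, g j x.1 • ζ j x).2.1 i = ∑ j, g j x.1 * (ζ j x).2.1 i := by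
  simp [Prod.fst_sum, Prod.snd_sum]

theorem lie1_prolong_kap12 (hg : ∀ j, ContDiff ℝ ∞ (g j)) (hζ : ∀ j, ContDiff ℝ ∞ (ζ j))
    (hv : ∀ j x, (ζ j x).1 = 0) (i : Fin n) (x w : E12 n k r) :
    lie1 (prolong g ζ) (kap12 n k r i) x w =
      ∑ j, g j x.1 * lie1 (ζ j) (kap12 n k r i) x w := by
  have hζd := fun j => (hζ j).differentiable (by simp)
  have hc : (fun y => (prolong g ζ y).2.1 i) = fun y => ∑ j, g j y.1 * (ζ j y).2.1 i := by
    ext y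
    rw [prolong_coord, sum_smul_coord]
  have hd : HasFDerivAt (fun y : E12 n k r => ∑ j, g j y.1 * (ζ j y).2.1 i) _ x :=
    HasFDerivAt.fun_sum (u := Finset.univ) fun j _ =>
      (((hg j).differentiable (by simp) x.1).hasDerivAt.comp_hasFDerivAt x
        (hasFDerivAt_id (𝕜 := ℝ) x).fst).mul (hasFDerivAt_coord (ζ j) (hζd j) i x)
  rw [lie1_kap12 ((contDiff_prolong hg hζ).differentiable (by simp)) (prolong_fst hv), hc,
    hd.fderiv]
  simp only [lie1_kap12 (hζd _) (hv _), ← fderiv_coord (hζd _)]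
  simp [prolong_velocity, Prod.fst_sum, Prod.snd_sum, Finset.sum_add_distrib, mul_sub,
    Finset.sum_sub_distrib, add_mul, Finset.sum_mul]
  simp only [mul_comm, mul_left_comm]
  ring_nf

theorem lie1_sum_smul_kap12 (hg : ∀ j, ContDiff ℝ ∞ (g j)) (hζ : ∀ j, ContDiff ℝ ∞ (ζ j))
    (hv : ∀ j x, (ζ j x).1 = 0) (i : Fin n) (x w : E12 n k r) :
    lie1 (fun x => ∑ j, g j x.1 • ζ j x) (kap12 n k r i) x w =
      lie1 (prolong g ζ) (kap12 n k r i) x w +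
        (∑ j, deriv (g j) x.1 • (ζ j x).2.1) i * w.1 := by
  rw [lie1_kap12 ((contDiff_prolong hg hζ).differentiable (by simp)) (prolong_fst hv),
    lie1_kap12 ((contDiff_sum_smul hg hζ).differentiable (by simp)) (sum_smul_fst hv)]
  simp only [prolong_coord, prolong_velocity, Pi.add_apply]
  ring

theorem InIdeal.sum_mul {I₀ : Set (E12 n k r → ℝ)} {f h : Fin m → E12 n k r → ℝ}
    (hf : ∀ j, ContDiff ℝ ∞ (f j)) (hh : ∀ j, InIdeal I₀ (h j)) :
    InIdeal I₀ fun x => ∑ j, f j x * h j x := by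
  choose M a b ha hb hab using hh
  let e := (finSigmaFinEquiv (n := M)).symm
  refine ⟨∑ j, M j, fun l x => f (e l).1 x * a (e l).1 (e l).2 x, fun l => b (e l).1 (e l).2,
    fun l => (hf _).mul (ha _ _), fun l => hb _ _, ?_⟩
  ext x
  rw [e.sum_comp (fun l => f l.1 x * a l.1 l.2 x * b l.1 l.2 x), Fintype.sum_sigma]
  refine Finset.sum_congr rfl fun j _ => ?_
  rw [hab j, Finset.mul_sum]
  exact Finset.sum_congr rfl fun l _ => (mul_assoc _ _ _).symm

/-- The prolongation of a `B(π)`-linear combination of admissible variations is admissible. -/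
theorem prolong_mem_Adm12 {I₀ : Set (E12 n k r → ℝ)} {η : Fin k → E12 n k r → E12 n k r → ℝ}
    (hη : ∀ a x, IsLinearMap ℝ (η a x))
    (hηv : ∀ (i : Fin n) a x, η a x (0, 0, Pi.single i 1, 0, 0) = 0)
    (hg : ∀ j, ContDiff ℝ ∞ (g j)) (hζ : ∀ j, ζ j ∈ Adm12 n k r I₀ η) :
    prolong g ζ ∈ Adm12 n k r I₀ η := by
  have hsm := fun j => (hζ j).1
  have hv := fun j => (hζ j).2.1
  have hgx : ∀ j, ContDiff ℝ ∞ fun x : E12 n k r => g j x.1 := fun j =>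
    (hg j).comp contDiff_fst
  refine ⟨contDiff_prolong hg hsm, prolong_fst hv, fun a => ?_, fun i => ?_⟩
  · have h : (fun x => η a x (prolong g ζ x)) = fun x => ∑ j, g j x.1 * η a x (ζ j x) := by
      ext x
      rw [prolong, (hη a x).map_add, map_velVec (hη a x)]
      simp only [hηv, mul_zero, Finset.sum_const_zero, add_zero]
      have := map_sum ((hη a x).mk' (η a x)) (fun j => g j x.1 • ζ j x) Finset.univ
      simpa only [IsLinearMap.mk'_apply, (hη a x).map_smul, smul_eq_mul] using this
    rw [h]
    exact InIdeal.sum_mul hgx fun j => (hζ j).2.2.1 a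
  · choose p q hp hq hpq using fun j => (hζ j).2.2.2 i
    refine ⟨fun l x => ∑ j, g j x.1 * p j l x, fun a x => ∑ j, g j x.1 * q j a x,
      fun l => ContDiff.sum fun j _ => (hgx j).mul (hp j l),
      fun a => ContDiff.sum fun j _ => (hgx j).mul (hq j a), fun x w => ?_⟩
    rw [lie1_prolong_kap12 hg hsm hv]
    simp only [hpq, mul_add, Finset.sum_add_distrib, Finset.sum_mul, Finset.mul_sum, mul_assoc]
    congr 1 <;> exact Finset.sum_comm

theorem InKapEtaSpan.eq_zero {η : Fin k → E12 n k r → E12 n k r → ℝ}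
    {α : E12 n k r → E12 n k r → ℝ} (hα : InKapEtaSpan n k r η α) {x w : E12 n k r}
    (hκ : ∀ i, kap12 n k r i x w = 0) (hηw : ∀ a, η a x w = 0) : α x w = 0 := by
  obtain ⟨p, q, -, -, h⟩ := hα
  simp [h, hκ, hηw]

/-- Multiplying the coefficients by `φ(t)` changes the prolongation by the Leibniz rule. -/
theorem prolong_mul {φ : ℝ → ℝ} (hφ : Differentiable ℝ φ) (hg : ∀ j, Differentiable ℝ (g j))
    (x : E12 n k r) :
    prolong (fun j t => φ t * g j t) ζ x =
      φ x.1 • prolong g ζ x + deriv φ x.1 • velVec n k r (∑ j, g j x.1 • ζ j x).2.1 := by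
  have hd : ∀ j, deriv (fun t => φ t * g j t) x.1 =
      deriv φ x.1 * g j x.1 + φ x.1 * deriv (g j) x.1 := fun j =>
    deriv_fun_mul (hφ _) (hg j _)
  have hc : (∑ j, g j x.1 • ζ j x).2.1 = ∑ j, g j x.1 • (ζ j x).2.1 := by
    simp only [Prod.snd_sum, Prod.fst_sum]
    rfl
  simp only [prolong, hd, hc]
  rw [smul_add, ← map_smul, ← map_smul, add_assoc, ← map_add, Finset.smul_sum, Finset.smul_sum,
    Finset.smul_sum, ← Finset.sum_add_distrib]
  simp only [smul_smul, add_smul, add_comm]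

end Geometry

theorem IsSection.deriv_proj {F : Type*} [NormedAddCommGroup F] [NormedSpace ℝ F]
    {γ : ℝ → ℝ × F} {I : Set ℝ} (h : IsSection Prod.fst γ I) {t : ℝ} (ht : t ∈ I) :
    (deriv γ t).1 = 1 := by
  have hd := ((h.smooth.differentiableOn (by simp)).differentiableAt
    (h.isOpen.mem_nhds ht)).hasDerivAt
  have h₁ : HasDerivAt (fun s => (γ s).1) (deriv γ t).1 t := hd.fst
  refine h₁.unique ((hasDerivAt_id t).congr_of_eventuallyEq ?_)
  filter_upwards [h.isOpen.mem_nhds ht] with s hs using h.proj s hs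

/-- For compatible constraints, the variational problem
`(L dt, (I₀, I₁ⁿʰ, I₁ᵛᵃᵏ), Adm)` is dynamically equivalent to the variational problem
`(Θ_L, (I₀, I₁ⁿʰ, I₁ᵛᵃᵏ), ⟨Adm⟩^{B(π)})`. -/
theorem mixed_constraints_poincare_cartan (n k r : ℕ) (L : E12 n k r → ℝ)
    (hL : ContDiff ℝ ∞ L)
    (I₀ : Set (E12 n k r → ℝ)) (hI₀ : ∀ f ∈ I₀, ContDiff ℝ ∞ f)
    (η : Fin k → E12 n k r → E12 n k r → ℝ) (hη : ∀ a, IsForm1 (η a))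
    (hcompat : CompatibleConstraints n k r η) :
    ∀ (γ : ℝ → E12 n k r) (I : Set ℝ),
      IsVPSol12 n k r (fun x w => L x * w.1) I₀ η (Adm12 n k r I₀ η) γ I ↔
        IsVPSol12 n k r (ThetaL12 n k r L) I₀ η (BSpan12 n k r (Adm12 n k r I₀ η)) γ I := by
  intro γ I
  have hLd : Differentiable ℝ L := hL.differentiable (by simp)
  constructor
  · rintro ⟨hγ, h₀, hηγ, hκγ, hvar⟩
    refine ⟨hγ, h₀, hηγ, hκγ, ?_⟩
    rintro K hK hKI _ ⟨m, g, ζ, hg, hζ, rfl⟩ hfr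
    have hsm := fun j => (hζ j).1
    have hv := fun j => (hζ j).2.1
    have hlin := fun a x => (hη a).2 x
    have hI := hγ.isOpen
    have hprol : ∀ t ∈ I, lie1 (fun x => ∑ j, g j x.1 • ζ j x) (ThetaL12 n k r L) (γ t)
        (deriv γ t) = fderiv ℝ L (γ t) (prolong g ζ (γ t)) := fun t ht => by
      have hw := hγ.deriv_proj ht
      rw [lie1_ThetaL12 ((contDiff_sum_smul hg hsm).differentiable (by simp)) (sum_smul_fst hv)
        hL hw fun i => hκγ i t ht]
      congr 2
      simp only [lie1_sum_smul_kap12 hg hsm hv, hw, mul_one,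
        ((prolong_mem_Adm12 hlin hcompat.2 hg hζ).2.2.2 _).eq_zero (fun i => hκγ i t ht)
          (fun a => hηγ a t ht), zero_add]
    rw [setIntegral_congr_fun hK.measurableSet fun t ht => hprol t (hKI ht)]
    have hLfd : ContDiff ℝ ∞ (fderiv ℝ L) := hL.fderiv_right (by simp)
    refine setIntegral_eq_zero_of_weak_eq (I := I)
      (B := fun t => fderiv ℝ L (γ t) (velVec n k r (∑ j, g j (γ t).1 • ζ j (γ t)).2.1))
      hI ?_ ?_ (fun φ hφ hφc hφI => ?_) hK hKI ?_
    · exact (hLfd.clm_apply (contDiff_prolong hg hsm)).continuous.comp_continuousOn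
        hγ.smooth.continuousOn
    · exact ((hLfd.clm_apply ((velVec n k r).contDiff.comp
        (contDiff_sum_smul hg hsm).snd.fst)).comp_contDiffOn hγ.smooth).of_le (by simp)
    · have hprolφ : ∀ t ∈ I, prolong (fun j t => φ t * g j t) ζ (γ t) =
          φ t • prolong g ζ (γ t) +
            deriv φ t • velVec n k r (∑ j, g j (γ t).1 • ζ j (γ t)).2.1 := fun t ht => by
        rw [prolong_mul (hφ.differentiable (by simp)) fun j => (hg j).differentiable (by simp),
          hγ.proj t ht]
      have hmem := prolong_mem_Adm12 hlin hcompat.2 (fun j => hφ.mul (hg j)) hζ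
      rw [← hvar (tsupport φ) hφc hφI _ hmem]
      · refine setIntegral_congr_fun hφc.measurableSet fun t ht => ?_
        rw [lie1_time (hmem.1.differentiable (by simp)) hmem.2.1 hLd,
          hγ.deriv_proj (hφI ht), hprolφ t (hφI ht)]
        simp
      · intro t ht
        rw [hprolφ t (hφI ((isClosed_tsupport φ).frontier_subset ht)),
          eq_zero_of_mem_frontier_tsupport hφ.continuous
            (fun s hs => image_eq_zero_of_notMem_tsupport hs) t ht,
          eq_zero_of_mem_frontier_tsupport (hφ.continuous_deriv (by simp))
            (fun s hs => image_eq_zero_of_notMem_tsupport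
              (fun h => hs (tsupport_deriv_subset h))) t ht]
        simp
    · intro t ht
      have h := hfr t ht
      simp only [h]
      simp
  · rintro ⟨hγ, h₀, hηγ, hκγ, hvar⟩
    refine ⟨hγ, h₀, hηγ, hκγ, fun K hK hKI ξ hξ hfr => ?_⟩
    rw [← hvar K hK hKI ξ ⟨1, fun _ _ => 1, fun _ => ξ, fun _ => contDiff_const, fun _ => hξ,
      by simp⟩ hfr]
    refine setIntegral_congr_fun hK.measurableSet fun t ht => ?_
    have hw := hγ.deriv_proj (hKI ht)
    have hξd : Differentiable ℝ ξ := hξ.1.differentiable (by simp)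
    have hz : (fun i => lie1 ξ (kap12 n k r i) (γ t) (deriv γ t)) = 0 := funext fun i =>
      (hξ.2.2.2 i).eq_zero (fun i => hκγ i t (hKI ht)) fun a => hηγ a t (hKI ht)
    rw [lie1_time hξd hξ.2.1 hLd, lie1_ThetaL12 hξd hξ.2.1 hL hw fun i => hκγ i t (hKI ht), hz, hw]
    simp

end VPGeom
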